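/- Let u ≠ 0 in ℝⁿ, F = {x ∈ ℝⁿ : ⟨x,u⟩ = 0}, F₁ = {x ∈ ℝⁿ : ⟨x,u⟩ = 1}, and let A be a real symmetric n×n matrix of strict negative type on F but not of negative type on ℝⁿ. Then M = sup_{x ∈ F₁} ⟨Ax,x⟩ is finite and positive, and there exists a unique element z ∈ F₁ such that ⟨Az,z⟩ = M. -/

import Mathlib

open Matrix

theorem Matrix.IsSymm.mulVec_dotProduct_comm {ι R : Type*} [Fintype ι] [CommSemiring R]
    {A : Matrix ι ι R} (hA : A.IsSymm) (x y : ι → R) :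
    A.mulVec x ⬝ᵥ y = A.mulVec y ⬝ᵥ x := by
  rw [dotProduct_comm, dotProduct_mulVec, ← mulVec_transpose, hA.eq]

/-- A symmetric matrix which is of strict negative type on the hyperplane `u⊥` but not of negative
type on the whole space is injective. -/
theorem Matrix.IsSymm.mulVec_injective_of_strict_neg_type {ι : Type*} [Fintype ι] {u : ι → ℝ}
    {A : Matrix ι ι ℝ} (hA : A.IsSymm)
    (hneg : ∀ x : ι → ℝ, x ⬝ᵥ u = 0 → A.mulVec x ⬝ᵥ x ≤ 0)
    (hstrict : ∀ x : ι → ℝ, x ⬝ᵥ u = 0 → A.mulVec x ⬝ᵥ x = 0 → x = 0)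
    (hnot : ∃ w : ι → ℝ, 0 < A.mulVec w ⬝ᵥ w) : Function.Injective A.mulVec := by
  obtain ⟨w, hw⟩ := hnot
  refine (injective_iff_map_eq_zero A.mulVecLin).2 fun x hx => ?_
  rw [mulVecLin_apply] at hx
  have hxu : x ⬝ᵥ u = 0 := by
    by_contra hc
    have h := hneg ((x ⬝ᵥ u) • w - (w ⬝ᵥ u) • x) (by
      simp only [sub_dotProduct, smul_dotProduct, smul_eq_mul]; ring)
    have hwx : A.mulVec w ⬝ᵥ x = 0 := by
      rw [hA.mulVec_dotProduct_comm, hx, zero_dotProduct]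
    simp only [mulVec_sub, mulVec_smul, hx, hwx, smul_zero, sub_zero, dotProduct_sub,
      dotProduct_smul, smul_dotProduct, smul_eq_mul, mul_zero] at h
    nlinarith [mul_pos (mul_self_pos.2 hc) hw]
  exact hstrict x hxu (by rw [hx, zero_dotProduct])

/-- Under the same hypotheses, the hyperplane `⟨x, u⟩ = 1` contains a point `z` whose image under
`A` is a multiple of `u`. -/
theorem Matrix.IsSymm.exists_mulVec_eq_smul_of_strict_neg_type {ι : Type*} [Fintype ι]
    {u : ι → ℝ} (hu : u ≠ 0) {A : Matrix ι ι ℝ} (hA : A.IsSymm)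
    (hneg : ∀ x : ι → ℝ, x ⬝ᵥ u = 0 → A.mulVec x ⬝ᵥ x ≤ 0)
    (hstrict : ∀ x : ι → ℝ, x ⬝ᵥ u = 0 → A.mulVec x ⬝ᵥ x = 0 → x = 0)
    (hnot : ∃ w : ι → ℝ, 0 < A.mulVec w ⬝ᵥ w) :
    ∃ (z : ι → ℝ) (c : ℝ), z ⬝ᵥ u = 1 ∧ A.mulVec z = c • u := by
  have hinj : Function.Injective A.mulVecLin :=
    hA.mulVec_injective_of_strict_neg_type hneg hstrict hnot
  obtain ⟨y, hy⟩ := LinearMap.injective_iff_surjective.1 hinj u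
  rw [mulVecLin_apply] at hy
  have hyu : y ⬝ᵥ u ≠ 0 := fun h => hu <| by
    rw [← hy, hstrict y h (by rw [hy, dotProduct_comm, h]), mulVec_zero]
  exact ⟨(y ⬝ᵥ u)⁻¹ • y, (y ⬝ᵥ u)⁻¹, by rw [smul_dotProduct, smul_eq_mul, inv_mul_cancel₀ hyu],
    by rw [mulVec_smul, hy]⟩

/-- For `u ≠ 0`, `F = {x : ⟨x,u⟩ = 0}`, `F₁ = {x : ⟨x,u⟩ = 1}`, and `A` symmetric of
strict negative type on `F` but not of negative type on `ℝⁿ`, the quantity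
`M = sup_{x ∈ F₁} ⟨Ax,x⟩` is finite and positive and there is a unique `z ∈ F₁` with
`⟨Az,z⟩ = M`. -/
theorem gap_sup_attained_unique {n : ℕ} (u : Fin n → ℝ) (hu : u ≠ 0)
    (A : Matrix (Fin n) (Fin n) ℝ) (hA : A.IsSymm)
    (hneg : ∀ x : Fin n → ℝ, x ⬝ᵥ u = 0 → A.mulVec x ⬝ᵥ x ≤ 0)
    (hstrict : ∀ x : Fin n → ℝ, x ⬝ᵥ u = 0 → A.mulVec x ⬝ᵥ x = 0 → x = 0)
    (hnot : ∃ w : Fin n → ℝ, 0 < A.mulVec w ⬝ᵥ w) :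
    BddAbove {r : ℝ | ∃ x : Fin n → ℝ, x ⬝ᵥ u = 1 ∧ r = A.mulVec x ⬝ᵥ x} ∧
    0 < sSup {r : ℝ | ∃ x : Fin n → ℝ, x ⬝ᵥ u = 1 ∧ r = A.mulVec x ⬝ᵥ x} ∧
    ∃! z : Fin n → ℝ, z ⬝ᵥ u = 1 ∧
      A.mulVec z ⬝ᵥ z = sSup {r : ℝ | ∃ x : Fin n → ℝ, x ⬝ᵥ u = 1 ∧ r = A.mulVec x ⬝ᵥ x} := by
  obtain ⟨z, c, hz, hAz⟩ := hA.exists_mulVec_eq_smul_of_strict_neg_type hu hneg hstrict hnot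
  have hsub : ∀ x : Fin n → ℝ, x ⬝ᵥ u = 1 → (x - z) ⬝ᵥ u = 0 := fun x hx => by
    rw [sub_dotProduct, hx, hz, sub_self]
  have hAz' : ∀ x : Fin n → ℝ, A.mulVec z ⬝ᵥ x = c * (x ⬝ᵥ u) := fun x => by
    rw [hAz, smul_dotProduct, smul_eq_mul, dotProduct_comm]
  have hdecomp : ∀ x : Fin n → ℝ, x ⬝ᵥ u = 1 →
      A.mulVec x ⬝ᵥ x = A.mulVec z ⬝ᵥ z + A.mulVec (x - z) ⬝ᵥ (x - z) := fun x hx => by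
    rw [mulVec_sub, sub_dotProduct, dotProduct_sub, dotProduct_sub,
      hA.mulVec_dotProduct_comm x z, hAz' x, hAz' z, hx, hz]
    ring
  have hmax : IsGreatest {r : ℝ | ∃ x : Fin n → ℝ, x ⬝ᵥ u = 1 ∧ r = A.mulVec x ⬝ᵥ x}
      (A.mulVec z ⬝ᵥ z) := by
    refine ⟨⟨z, hz, rfl⟩, ?_⟩
    rintro _ ⟨x, hx, rfl⟩
    linarith [hdecomp x hx, hneg _ (hsub x hx)]
  rw [hmax.csSup_eq]
  refine ⟨hmax.bddAbove, ?_, z, ⟨hz, rfl⟩, ?_⟩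
  · obtain ⟨w, hw⟩ := hnot
    have hwu : w ⬝ᵥ u ≠ 0 := fun h => (hneg w h).not_gt hw
    refine lt_of_lt_of_le ?_ (hmax.2 ⟨(w ⬝ᵥ u)⁻¹ • w, ?_, rfl⟩)
    · rw [mulVec_smul, smul_dotProduct, dotProduct_smul, smul_eq_mul, smul_eq_mul, ← mul_assoc]
      exact mul_pos (mul_self_pos.2 (inv_ne_zero hwu)) hw
    · rw [smul_dotProduct, smul_eq_mul, inv_mul_cancel₀ hwu]
  · rintro x ⟨hx, hxM⟩
    exact sub_eq_zero.1 (hstrict _ (hsub x hx) (by linarith [hdecomp x hx]))
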